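/- Let A be a commutative ring and M an A-module. Then the trivial extension (Nagata idealization) A⋉M is Cohen-Macaulay in the sense of ideals if and only if A is Cohen-Macaulay in the sense of ideals and kgr_A(𝔞, M) ≥ height 𝔞 for every ideal 𝔞 of A. -/

import Mathlib

/-- The Koszul cochain differential of the complex `Hom(K_•(x), M)`, described explicitly:
the degree-`i` term is the module of `M`-valued functions on the `i`-element subsets of
`Fin n`, and the differential is the usual alternating-sum formula. -/
noncomputable def koszulMap (A : Type*) [CommRing A] (M : Type*) [AddCommGroup M]
    [Module A M] {n : ℕ} (x : Fin n → A) (i : ℕ) :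
    ({s : Finset (Fin n) // s.card = i} → M) →ₗ[A]
      ({s : Finset (Fin n) // s.card = i + 1} → M) where
  toFun g t := ∑ j ∈ t.1.attach,
    (((-1 : A) ^ ((t.1.filter (fun k => k < j.1)).card)) * x j.1) •
      g ⟨t.1.erase j.1, by
        rw [Finset.card_erase_of_mem j.2, t.2]; omega⟩

  map_add' g h := funext fun t => by
    simp [smul_add, Finset.sum_add_distrib]
  map_smul' a g := funext fun t => by
    simp only [Pi.smul_apply, RingHom.id_apply, Finset.smul_sum]
    exact Finset.sum_congr rfl fun j _ => by
      rw [smul_smul, smul_smul, mul_comm]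

/-- Nonvanishing of the `i`-th cohomology `H^i(Hom(K_•(x), M))` of the Koszul
cochain complex. -/
def koszulCohomologyNeZero (A : Type*) [CommRing A] (M : Type*) [AddCommGroup M]
    [Module A M] {n : ℕ} (x : Fin n → A) : ℕ → Prop
  | 0 => LinearMap.ker (koszulMap A M x 0) ≠ ⊥
  | (i + 1) => ¬ (LinearMap.ker (koszulMap A M x (i + 1)) ≤
      LinearMap.range (koszulMap A M x i))

/-- The Koszul grade of a finite sequence `x` on `M`:
`inf { i : H^i(Hom(K_•(x), M)) ≠ 0 }` (an element of `ℕ∞`, equal to `⊤` if all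
cohomology vanishes). -/
noncomputable def kgrSeq (A : Type*) [CommRing A] (M : Type*) [AddCommGroup M]
    [Module A M] {n : ℕ} (x : Fin n → A) : ℕ∞ :=
  sInf {i : ℕ∞ | ∃ k : ℕ, i = k ∧ koszulCohomologyNeZero A M x k}

/-- The Koszul grade `kgr_A(𝔞, M)` of an arbitrary ideal `𝔞` on `M`: the supremum of the
Koszul grades of finite sequences contained in `𝔞` (equivalently, of the finitely
generated subideals of `𝔞`). -/
noncomputable def kgr (A : Type*) [CommRing A] (𝔞 : Ideal A) (M : Type*)
    [AddCommGroup M] [Module A M] : ℕ∞ :=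
  ⨆ (n : ℕ) (x : Fin n → A) (_ : ∀ j, x j ∈ 𝔞), kgrSeq A M x

/-- The height of an ideal: the infimum of the heights of the primes containing it. -/
noncomputable def idealHeight (A : Type*) [CommRing A] (𝔞 : Ideal A) : ℕ∞ :=
  ⨅ (p : PrimeSpectrum A) (_ : 𝔞 ≤ p.asIdeal), Order.height p

/-- A commutative ring `R` is Cohen-Macaulay in the sense of a class `𝒜` of ideals if
`height 𝔞 = kgr_R(𝔞, R)` for every `𝔞 ∈ 𝒜`. -/
def IsCMSense (R : Type*) [CommRing R] (𝒜 : Set (Ideal R)) : Prop :=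
  ∀ 𝔞 ∈ 𝒜, idealHeight R 𝔞 = kgr R 𝔞 R

/-- Cohen-Macaulay in the sense of ideals. -/
def IsCMIdeals (R : Type*) [CommRing R] : Prop :=
  ∀ 𝔞 : Ideal R, idealHeight R 𝔞 = kgr R 𝔞 R

/-- Cohen-Macaulay in the sense of maximal ideals. -/
def IsCMMaximal (R : Type*) [CommRing R] : Prop :=
  ∀ 𝔪 : Ideal R, 𝔪.IsMaximal → idealHeight R 𝔪 = kgr R 𝔪 R

/-- The amalgamation `A ⋈^f J = {(a, f a + j) : a ∈ A, j ∈ J}` of `A` with `B` along the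
ideal `J` of `B` with respect to `f : A →+* B`, as a subring of `A × B`. -/
def amalgamation {A B : Type*} [CommRing A] [CommRing B] (f : A →+* B) (J : Ideal B) :
    Subring (A × B) where
  carrier := {p | p.2 - f p.1 ∈ J}
  zero_mem' := by simp
  one_mem' := by simp
  add_mem' := fun {p q} hp hq => by
    have := J.add_mem hp hq
    simpa [add_sub_add_comm] using this
  neg_mem' := fun {p} hp => by
    show (-p).2 - f ((-p).1) ∈ J
    have key : (-p).2 - f ((-p).1) = -(p.2 - f p.1) := by
      simp only [Prod.fst_neg, Prod.snd_neg, map_neg]; ring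
    rw [key]
    exact J.neg_mem hp
  mul_mem' := fun {p q} hp hq => by
    show (p * q).2 - f ((p * q).1) ∈ J
    have key : (p * q).2 - f ((p * q).1)
        = p.2 * (q.2 - f q.1) + (p.2 - f p.1) * f q.1 := by
      simp only [Prod.fst_mul, Prod.snd_mul, map_mul]; ring
    rw [key]
    exact J.add_mem (J.mul_mem_left _ hq) (J.mul_mem_right _ hp)

/-- The natural embedding `ι_A : A → A ⋈^f J`, `a ↦ (a, f a)`. -/
def amalgIota {A B : Type*} [CommRing A] [CommRing B] (f : A →+* B) (J : Ideal B) :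
    A →+* amalgamation f J where
  toFun a := ⟨(a, f a), show (a, f a).2 - f (a, f a).1 ∈ J by simp⟩
  map_one' := Subtype.ext (by simp)
  map_mul' a b := Subtype.ext (by simp)
  map_zero' := Subtype.ext (by simp)
  map_add' a b := Subtype.ext (by simp)

/-- The extension `𝔞^e = 𝔞(A ⋈^f J)` of an ideal `𝔞` of `A` along `ι_A`. -/
noncomputable def idealExt {A B : Type*} [CommRing A] [CommRing B] (f : A →+* B)
    (J : Ideal B) (𝔞 : Ideal A) : Ideal ↥(amalgamation f J) :=
  Ideal.map (amalgIota f J) 𝔞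

/-- `kgr_A(𝔞, J)` where the ideal `J` of `B` is viewed as an `A`-module via `f`. -/
noncomputable def kgrIdeal {A B : Type*} [CommRing A] [CommRing B] (f : A →+* B)
    (J : Ideal B) (𝔞 : Ideal A) : ℕ∞ :=
  letI : Module A J := Module.compHom J f
  kgr A 𝔞 J

/-- The ideal `𝔭'^f = 𝔭 ⋈^f J = {(p, f p + j) : p ∈ 𝔭, j ∈ J}` of `A ⋈^f J`. -/
def primeAmalg {A B : Type*} [CommRing A] [CommRing B] (f : A →+* B) (J : Ideal B)
    (𝔭 : Ideal A) : Ideal ↥(amalgamation f J) where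
  carrier := {z | (z : A × B).1 ∈ 𝔭}
  zero_mem' := by simp
  add_mem' := fun {a b} ha hb => 𝔭.add_mem ha hb
  smul_mem' := fun c {z} hz => 𝔭.mul_mem_left (c : A × B).1 hz

/-- The ideal `𝔮̄^f = {(a, f a + j) : a ∈ A, j ∈ J, f a + j ∈ 𝔮}` of `A ⋈^f J`. -/
def qbarAmalg {A B : Type*} [CommRing A] [CommRing B] (f : A →+* B) (J : Ideal B)
    (𝔮 : Ideal B) : Ideal ↥(amalgamation f J) where
  carrier := {z | (z : A × B).2 ∈ 𝔮}
  zero_mem' := by simp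
  add_mem' := fun {a b} ha hb => 𝔮.add_mem ha hb
  smul_mem' := fun c {z} hz => 𝔮.mul_mem_left (c : A × B).2 hz

/-- A ring homomorphism `f : A →+* B` satisfies the going-down property. -/
def RingHom.GoesDown {A B : Type*} [CommRing A] [CommRing B] (f : A →+* B) : Prop :=
  ∀ (𝔭' 𝔭 : Ideal A), 𝔭'.IsPrime → 𝔭.IsPrime → 𝔭' ≤ 𝔭 →
    ∀ 𝔮 : Ideal B, 𝔮.IsPrime → 𝔮.comap f = 𝔭 →
      ∃ 𝔮' : Ideal B, 𝔮'.IsPrime ∧ 𝔮' ≤ 𝔮 ∧ 𝔮'.comap f = 𝔭'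

open Finset in
/-- The Koszul differential on functions of all finite subsets of a linearly ordered index type. -/
def koszulDiff {A M ι : Type*} [CommRing A] [AddCommGroup M] [Module A M] [LinearOrder ι]
    (x : ι → A) (g : Finset ι → M) (t : Finset ι) : M :=
  ∑ j ∈ t, ((-1 : A) ^ #{k ∈ t | k < j} * x j) • g (t.erase j)

open Finset in
/-- Contraction against the basis vector `p`. -/
def koszulContract (A : Type*) {M ι : Type*} [CommRing A] [AddCommGroup M] [Module A M]
    [LinearOrder ι] (p : ι) (g : Finset ι → M) (t : Finset ι) : M :=
  if p ∈ t then 0 else (-1 : A) ^ #{k ∈ t | k < p} • g (insert p t)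

open Finset in
/-- The cochain restricting to `a` on the subsets avoiding `p`, with contraction `b`. -/
def koszulGlue (A : Type*) {M ι : Type*} [CommRing A] [AddCommGroup M] [Module A M]
    [LinearOrder ι] (p : ι) (a b : Finset ι → M) (t : Finset ι) : M :=
  if p ∈ t then (-1 : A) ^ #{k ∈ t | k < p} • b (t.erase p) else a t

/-- Exactness in degree `i`, up to multiplication by elements of `P`, of the Koszul complex
of the subfamily of `x` indexed by `S`. -/
def KoszulExactAt {A : Type*} (M : Type*) {ι : Type*} [CommRing A] [AddCommGroup M] [Module A M]
    [LinearOrder ι] (P : Submonoid A) (x : ι → A) (S : Finset ι) (i : ℕ) : Prop :=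
  ∀ g : Finset ι → M, (∀ t ⊆ S, t.card = i + 1 → koszulDiff x g t = 0) →
    ∃ s ∈ P, ∃ h : Finset ι → M, ∀ t ⊆ S, t.card = i → koszulDiff x h t = s • g t

section Koszul

variable {A M ι : Type*} [CommRing A] [AddCommGroup M] [Module A M] [LinearOrder ι]

theorem koszulDiff_congr {x : ι → A} {g h : Finset ι → M} {t : Finset ι}
    (H : ∀ j ∈ t, g (t.erase j) = h (t.erase j)) : koszulDiff x g t = koszulDiff x h t :=
  Finset.sum_congr rfl fun j hj => by rw [H j hj]

theorem koszulDiff_add (x : ι → A) (g h : Finset ι → M) (t : Finset ι) :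
    koszulDiff x (g + h) t = koszulDiff x g t + koszulDiff x h t := by
  simp [koszulDiff, Finset.sum_add_distrib]

theorem koszulDiff_sub (x : ι → A) (g h : Finset ι → M) (t : Finset ι) :
    koszulDiff x (g - h) t = koszulDiff x g t - koszulDiff x h t := by
  simp [koszulDiff, smul_sub, Finset.sum_sub_distrib]

theorem koszulDiff_smul (x : ι → A) (a : A) (g : Finset ι → M) (t : Finset ι) :
    koszulDiff x (a • g) t = a • koszulDiff x g t := by
  simp only [koszulDiff, Finset.smul_sum, Pi.smul_apply]
  exact Finset.sum_congr rfl fun j _ => smul_comm _ _ _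

theorem koszulDiff_comp_linearMap {N : Type*} [AddCommGroup N] [Module A N] (x : ι → A)
    (f : M →ₗ[A] N) (g : Finset ι → M) (t : Finset ι) :
    koszulDiff x (fun u => f (g u)) t = f (koszulDiff x g t) := by
  simp [koszulDiff]

theorem koszulDiff_map {κ : Type*} [LinearOrder κ] (e : ι ↪o κ) (x : κ → A)
    (g : Finset κ → M) (t : Finset ι) :
    koszulDiff x g (t.map e.toEmbedding) =
      koszulDiff (x ∘ e) (fun u => g (u.map e.toEmbedding)) t := by
  simp only [koszulDiff, Finset.sum_map]
  refine Finset.sum_congr rfl fun j _ => ?_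
  rw [Finset.filter_map, Finset.card_map, Finset.map_erase]
  simp

theorem neg_one_pow_smul_self (n : ℕ) (m : M) : (-1 : A) ^ n • (-1 : A) ^ n • m = m := by
  rw [smul_smul, ← mul_pow]; simp

/-- Contraction against `p` is a homotopy between `0` and multiplication by `x p`. -/
theorem koszulDiff_contract_add (x : ι → A) (p : ι) (g : Finset ι → M) (t : Finset ι) :
    koszulDiff x (koszulContract A p g) t + koszulContract A p (koszulDiff x g) t
      = x p • g t := by
  by_cases hp : p ∈ t
  · rw [koszulContract, if_pos hp, add_zero, koszulDiff, Finset.sum_eq_single_of_mem p hp]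
    · have : (t.erase p).filter (· < p) = t.filter (· < p) := by
        ext k; simp only [Finset.mem_filter, Finset.mem_erase]; grind
      rw [koszulContract, if_neg (Finset.notMem_erase p t), this, Finset.insert_erase hp,
        mul_comm, mul_smul, neg_one_pow_smul_self]
    · intro j _ hj
      rw [koszulContract, if_pos (Finset.mem_erase.2 ⟨hj.symm, hp⟩), smul_zero]
  · have h0 : (insert p t).filter (· < p) = t.filter (· < p) := by
      rw [Finset.filter_insert, if_neg (lt_irrefl p)]
    rw [koszulContract, if_neg hp, koszulDiff, koszulDiff, Finset.sum_insert hp, smul_add, h0,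
      Finset.erase_insert hp, mul_smul, neg_one_pow_smul_self, add_left_comm, Finset.smul_sum,
      ← Finset.sum_add_distrib, Finset.sum_eq_zero, add_zero]
    intro j hj
    have hjp : j ≠ p := fun h => hp (h ▸ hj)
    have hpj : p ∉ t.erase j := fun h => hp (Finset.mem_of_mem_erase h)
    rw [koszulContract, if_neg hpj, Finset.erase_insert_of_ne hjp.symm, smul_smul, smul_smul,
      ← add_smul, Finset.filter_insert, Finset.filter_erase]
    convert zero_smul A _
    rcases lt_or_gt_of_ne hjp with h | h
    · have hm : j ∈ t.filter (· < p) := Finset.mem_filter.2 ⟨hj, h⟩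
      rw [if_neg h.not_gt, ← Finset.card_erase_add_one hm, pow_succ]
      ring
    · have hm : j ∉ t.filter (· < p) := fun h' => h.not_gt (Finset.mem_filter.1 h').2
      have hm' : p ∉ t.filter (· < j) := fun h' => hp (Finset.mem_filter.1 h').1
      rw [if_pos h, Finset.erase_eq_of_notMem hm, Finset.card_insert_of_notMem hm', pow_succ]
      ring

theorem koszulDiff_glue_of_notMem (x : ι → A) {p : ι} (a b : Finset ι → M) {t : Finset ι}
    (hp : p ∉ t) : koszulDiff x (koszulGlue A p a b) t = koszulDiff x a t :=
  koszulDiff_congr fun _ _ => if_neg fun h => hp (Finset.mem_of_mem_erase h)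

theorem koszulContract_glue (p : ι) (a b : Finset ι → M) {t : Finset ι} (hp : p ∉ t) :
    koszulContract A p (koszulGlue A p a b) t = b t := by
  rw [koszulContract, if_neg hp, koszulGlue, if_pos (Finset.mem_insert_self p t),
    Finset.filter_insert, if_neg (lt_irrefl p), neg_one_pow_smul_self, Finset.erase_insert hp]

theorem koszulContract_koszulDiff_glue (x : ι → A) {p : ι} (a b : Finset ι → M) {t : Finset ι}
    (hp : p ∉ t) :
    koszulContract A p (koszulDiff x (koszulGlue A p a b)) t = x p • a t - koszulDiff x b t := by
  have h := koszulDiff_contract_add x p (koszulGlue A p a b) t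
  have h1 : koszulDiff x (koszulContract A p (koszulGlue A p a b)) t = koszulDiff x b t :=
    koszulDiff_congr fun _ _ =>
      koszulContract_glue p a b fun h => hp (Finset.mem_of_mem_erase h)
  rw [h1] at h
  rw [eq_sub_iff_add_eq', h, koszulGlue, if_neg hp]

theorem koszulContract_insert_eq (p : ι) (g : Finset ι → M) {t : Finset ι} (hp : p ∉ t) :
    g (insert p t) = (-1 : A) ^ (t.filter (· < p)).card • koszulContract A p g t := by
  rw [koszulContract, if_neg hp, neg_one_pow_smul_self]

variable {P : Submonoid A} {x : ι → A} {S : Finset ι}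

theorem KoszulExactAt.insert_of_notMem {p : ι} (hp : p ∉ S) {i : ℕ}
    (h : ∀ j ≤ i, KoszulExactAt M P x S j) : KoszulExactAt M P x (insert p S) i := by
  intro g hg
  obtain ⟨s, hs, h0, hh0⟩ := h i le_rfl g fun t ht => hg t (ht.trans (Finset.subset_insert p S))
  rcases i with _ | i
  · refine ⟨s, hs, h0, fun t ht hc => hh0 t ?_ hc⟩
    rw [Finset.card_eq_zero.1 hc]
    exact Finset.empty_subset S
  · obtain ⟨s', hs', h1, hh1⟩ := h i i.le_succ (x p • h0 - s • koszulContract A p g) (by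
      intro t ht hc
      have hpt : p ∉ t := fun h => hp (ht h)
      rw [koszulDiff_sub, koszulDiff_smul, koszulDiff_smul, hh0 t ht hc, smul_comm, ← smul_sub]
      have := koszulDiff_contract_add x p g t
      rw [← this, koszulContract.eq_def A p (koszulDiff x g), if_neg hpt,
        hg _ (Finset.insert_subset_insert p ht) (by rw [Finset.card_insert_of_notMem hpt, hc])]
      simp)
    refine ⟨s' * s, mul_mem hs' hs, koszulGlue A p (s' • h0) h1, fun t ht hc => ?_⟩
    by_cases hpt : p ∈ t
    · obtain ⟨u, hu, rfl⟩ : ∃ u, p ∉ u ∧ insert p u = t :=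
        ⟨t.erase p, Finset.notMem_erase p t, Finset.insert_erase hpt⟩
      have huS : u ⊆ S := (Finset.insert_subset_insert_iff hu).1 ht
      have huc : u.card = i := by
        rw [Finset.card_insert_of_notMem hu] at hc; omega
      rw [koszulContract_insert_eq (A := A) p (koszulDiff x _) hu,
        koszulContract_koszulDiff_glue x _ _ hu, hh1 u huS huc,
        koszulContract_insert_eq (A := A) p g hu]
      simp only [Pi.smul_apply, Pi.sub_apply, smul_sub, smul_smul]
      module
    · have htS : t ⊆ S := (Finset.subset_insert_iff_of_notMem hpt).1 ht
      rw [koszulDiff_glue_of_notMem x _ _ hpt, koszulDiff_smul, hh0 t htS hc, smul_smul]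

theorem KoszulExactAt.of_insert {p : ι} (hp : p ∉ S) {i : ℕ}
    (h : KoszulExactAt M P x (insert p S) i) {s : A} (hs : s ∈ P)
    (hr : s * x p ∈ (Ideal.span (x '' S)).radical) : KoszulExactAt M P x S i := by
  intro g hg
  obtain ⟨n, hn⟩ := hr
  have cancel : ∀ n : ℕ, ∀ s ∈ P,
      (∃ h : Finset ι → M, ∀ t ⊆ S, t.card = i → koszulDiff x h t = (s * x p ^ n) • g t) →
      ∃ s ∈ P, ∃ h : Finset ι → M, ∀ t ⊆ S, t.card = i → koszulDiff x h t = s • g t := by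
    intro n
    induction n with
    | zero => intro s hs ⟨k, hk⟩; exact ⟨s, hs, k, by simpa using hk⟩
    | succ n ih =>
      intro s hs ⟨k, hk⟩
      obtain ⟨s', hs', H, hH⟩ := h (koszulGlue A p ((s * x p ^ n) • g) k) (by
        intro t ht hc
        by_cases hpt : p ∈ t
        · obtain ⟨u, hu, rfl⟩ : ∃ u, p ∉ u ∧ insert p u = t :=
            ⟨t.erase p, Finset.notMem_erase p t, Finset.insert_erase hpt⟩
          have huS : u ⊆ S := (Finset.insert_subset_insert_iff hu).1 ht
          have huc : u.card = i := by
            rw [Finset.card_insert_of_notMem hu] at hc; omega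
          rw [koszulContract_insert_eq (A := A) p (koszulDiff x _) hu,
            koszulContract_koszulDiff_glue x _ _ hu, hk u huS huc, Pi.smul_apply]
          module
        · have htS : t ⊆ S := (Finset.subset_insert_iff_of_notMem hpt).1 ht
          rw [koszulDiff_glue_of_notMem x _ _ hpt, koszulDiff_smul, hg t htS hc, smul_zero])
      refine ih (s' * s) (mul_mem hs' hs) ⟨H, fun t ht hc => ?_⟩
      rw [hH t (ht.trans (Finset.subset_insert p S)) hc, koszulGlue,
        if_neg fun h => hp (ht h), Pi.smul_apply, smul_smul, mul_assoc]
  refine cancel n (s ^ n) (pow_mem hs n) ?_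
  rw [← mul_pow]
  generalize (s * x p) ^ n = a at hn ⊢
  induction hn using Submodule.span_induction with
  | mem a ha =>
    obtain ⟨q, hq, rfl⟩ := ha
    refine ⟨koszulContract A q g, fun t ht hc => ?_⟩
    rw [← koszulDiff_contract_add x q g t, koszulContract.eq_def A q (koszulDiff x g)]
    split_ifs with hqt
    · simp
    · rw [hg _ (Finset.insert_subset hq ht) (by rw [Finset.card_insert_of_notMem hqt, hc])]
      simp
  | zero => exact ⟨0, fun t _ _ => by simp [koszulDiff]⟩
  | add a b _ _ ha hb =>
    obtain ⟨k, hk⟩ := ha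
    obtain ⟨l, hl⟩ := hb
    exact ⟨k + l, fun t ht hc => by rw [koszulDiff_add, hk t ht hc, hl t ht hc, add_smul]⟩
  | smul c a _ ha =>
    obtain ⟨k, hk⟩ := ha
    exact ⟨c • k, fun t ht hc => by rw [koszulDiff_smul, hk t ht hc, smul_smul, smul_eq_mul]⟩

theorem KoszulExactAt.union (T : Finset ι) {i : ℕ}
    (h : ∀ j ≤ i, KoszulExactAt M P x S j) : ∀ j ≤ i, KoszulExactAt M P x (T ∪ S) j := by
  induction T using Finset.induction_on with
  | empty => simpa using h
  | insert p T _ ih =>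
    rw [Finset.insert_union]
    by_cases hp : p ∈ T ∪ S
    · rwa [Finset.insert_eq_of_mem hp]
    · exact fun j hj => KoszulExactAt.insert_of_notMem hp fun k hk => ih k (hk.trans hj)

theorem KoszulExactAt.of_union (T : Finset ι) {i : ℕ} (h : KoszulExactAt M P x (T ∪ S) i)
    (hr : ∀ p ∈ T, ∃ s ∈ P, s * x p ∈ (Ideal.span (x '' S)).radical) :
    KoszulExactAt M P x S i := by
  induction T using Finset.induction_on with
  | empty => simpa using h
  | insert p T _ ih =>
    refine ih ?_ fun q hq => hr q (Finset.mem_insert_of_mem hq)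
    rw [Finset.insert_union] at h
    by_cases hp : p ∈ T ∪ S
    · rwa [Finset.insert_eq_of_mem hp] at h
    · obtain ⟨s, hs, hsx⟩ := hr p (Finset.mem_insert_self p T)
      refine h.of_insert hp hs (Ideal.radical_mono (Ideal.span_mono ?_) hsx)
      exact Set.image_mono (by simp)

theorem koszulExactAt_map_iff {κ : Type*} [LinearOrder κ] (e : ι ↪o κ) (x : κ → A) (i : ℕ) :
    KoszulExactAt M P x (S.map e.toEmbedding) i ↔ KoszulExactAt M P (x ∘ e) S i := by
  have ext_map (g : Finset ι → M) (t : Finset ι) : Function.extend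
      (Finset.map e.toEmbedding) g 0 (t.map e.toEmbedding) = g t :=
    (Finset.map_injective e.toEmbedding).extend_apply _ _ _
  constructor
  · intro h g hg
    obtain ⟨s, hs, k, hk⟩ := h (Function.extend (Finset.map e.toEmbedding) g 0) (by
      intro t ht hc
      obtain ⟨u, hu, rfl⟩ := Finset.subset_map_iff.1 ht
      rw [Finset.card_map] at hc
      simpa only [koszulDiff_map, ext_map] using hg u hu hc)
    refine ⟨s, hs, fun u => k (u.map e.toEmbedding), fun t ht hc => ?_⟩
    rw [← koszulDiff_map, hk _ (Finset.map_subset_map.2 ht) (by rwa [Finset.card_map]), ext_map]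
  · intro h g hg
    obtain ⟨s, hs, k, hk⟩ := h (fun u => g (u.map e.toEmbedding)) (by
      intro t ht hc
      rw [← koszulDiff_map]
      exact hg _ (Finset.map_subset_map.2 ht) (by rwa [Finset.card_map]))
    refine ⟨s, hs, Function.extend (Finset.map e.toEmbedding) k 0, fun t ht hc => ?_⟩
    obtain ⟨u, hu, rfl⟩ := Finset.subset_map_iff.1 ht
    rw [Finset.card_map] at hc
    simpa only [koszulDiff_map, ext_map] using hk u hu hc

end Koszul

section KoszulGrade

variable {A M : Type*} [CommRing A] [AddCommGroup M] [Module A M]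

theorem koszulMap_apply {n : ℕ} (x : Fin n → A) (i : ℕ) (g : Finset (Fin n) → M)
    (t : {s : Finset (Fin n) // s.card = i + 1}) :
    koszulMap A M x i (fun u => g u.1) t = koszulDiff x g t.1 :=
  Finset.sum_attach t.1 fun j =>
    ((-1 : A) ^ (t.1.filter (fun k => k < j)).card * x j) • g (t.1.erase j)

theorem exists_eq_restrict {n i : ℕ} (g : {s : Finset (Fin n) // s.card = i} → M) :
    ∃ g' : Finset (Fin n) → M, g = fun u => g' u.1 :=
  ⟨Function.extend Subtype.val g 0, funext fun u =>
    (Subtype.val_injective.extend_apply g 0 u).symm⟩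

theorem koszulExactAt_bot_iff {n : ℕ} (x : Fin n → A) (i : ℕ) :
    KoszulExactAt M ⊥ x Finset.univ i ↔ ¬ koszulCohomologyNeZero A M x i := by
  have key : KoszulExactAt M ⊥ x Finset.univ i ↔
      ∀ g : Finset (Fin n) → M, (fun u => g u.1) ∈ LinearMap.ker (koszulMap A M x i) →
        ∃ h : Finset (Fin n) → M, ∀ t, t.card = i → koszulDiff x h t = g t := by
    simp only [KoszulExactAt, Submonoid.mem_bot, exists_eq_left, one_smul, Finset.subset_univ,
      true_imp_iff, LinearMap.mem_ker, funext_iff, koszulMap_apply, Pi.zero_apply, Subtype.forall]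
  rw [key]
  rcases i with _ | i
  · simp only [koszulCohomologyNeZero, ne_eq, not_not, Submodule.eq_bot_iff]
    constructor
    · intro H g hg
      obtain ⟨g, rfl⟩ := exists_eq_restrict g
      obtain ⟨h, hh⟩ := H g hg
      funext u
      rw [← hh u.1 u.2, Finset.card_eq_zero.1 u.2]
      simp [koszulDiff]
    · intro H g hg
      refine ⟨0, fun t ht => ?_⟩
      have := congrFun (H _ hg) ⟨t, ht⟩
      simpa [koszulDiff] using this.symm
  · simp only [koszulCohomologyNeZero, not_not]
    constructor
    · intro H g hg
      obtain ⟨g, rfl⟩ := exists_eq_restrict g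
      obtain ⟨h, hh⟩ := H g hg
      exact ⟨fun u => h u.1, funext fun t => (koszulMap_apply x i h t).trans (hh t.1 t.2)⟩
    · intro H g hg
      obtain ⟨h, hh⟩ := H hg
      obtain ⟨h, rfl⟩ := exists_eq_restrict h
      exact ⟨h, fun t ht => (koszulMap_apply x i h ⟨t, ht⟩).symm.trans (congrFun hh ⟨t, ht⟩)⟩

theorem le_kgrSeq_iff {n : ℕ} (x : Fin n → A) (c : ℕ∞) :
    c ≤ kgrSeq A M x ↔ ∀ i : ℕ, (i : ℕ∞) < c → KoszulExactAt M ⊥ x Finset.univ i := by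
  simp only [kgrSeq, le_sInf_iff, koszulExactAt_bot_iff]
  constructor
  · intro h i hi hne
    exact (h i ⟨i, rfl, hne⟩).not_gt hi
  · rintro h _ ⟨i, rfl, hne⟩
    by_contra! hi
    exact h i hi hne

theorem KoszulExactAt.mono {ι : Type*} [LinearOrder ι] {P Q : Submonoid A} (hPQ : P ≤ Q)
    {x : ι → A} {S : Finset ι} {i : ℕ} (h : KoszulExactAt M P x S i) :
    KoszulExactAt M Q x S i := fun g hg =>
  let ⟨s, hs, H⟩ := h g hg
  ⟨s, hPQ hs, H⟩

theorem KoszulExactAt.append {P : Submonoid A} {m n : ℕ} {x : Fin m → A} (y : Fin n → A) {i : ℕ}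
    (h : ∀ j ≤ i, KoszulExactAt M P x Finset.univ j) :
    KoszulExactAt M P (Fin.append x y) Finset.univ i := by
  have hx : (Fin.append x y) ∘ (Fin.castAddOrderEmb n) = x := by
    ext j; simp
  have := KoszulExactAt.union (M := M) (P := P) (x := Fin.append x y)
    (S := Finset.univ.map (Fin.castAddOrderEmb n).toEmbedding) Finset.univ (i := i)
    (fun j hj => by rw [koszulExactAt_map_iff, hx]; exact h j hj) i le_rfl
  rwa [Finset.union_eq_left.2 (Finset.subset_univ _)] at this

theorem KoszulExactAt.of_mem_radical {P : Submonoid A} {m n : ℕ} {x : Fin m → A} {y : Fin n → A}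
    (hr : ∀ j, ∃ s ∈ P, s * x j ∈ (Ideal.span (Set.range y)).radical) {i : ℕ}
    (h : ∀ j ≤ i, KoszulExactAt M P x Finset.univ j) :
    KoszulExactAt M P y Finset.univ i := by
  have hy : (Fin.append x y) ∘ (Fin.natAddOrderEmb m) = y := by
    ext j; simp
  have hS : Fin.append x y '' (Finset.univ.map (Fin.natAddOrderEmb m).toEmbedding :
      Finset (Fin (m + n))) = Set.range y := by
    rw [Finset.coe_map, Finset.coe_univ, Set.image_univ, ← Set.range_comp]
    exact congrArg Set.range hy
  rw [← hy, ← koszulExactAt_map_iff]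
  refine KoszulExactAt.of_union Finset.univ ?_ ?_
  · rw [Finset.union_eq_left.2 (Finset.subset_univ _)]
    exact KoszulExactAt.append y h
  · rw [hS]
    intro p _
    refine Fin.addCases (fun j => ?_) (fun j => ?_) p
    · simpa using hr j
    · exact ⟨1, one_mem P, by
        simpa using Ideal.le_radical (Ideal.subset_span (Set.mem_range_self j))⟩

theorem kgrSeq_le_of_mem_radical {m n : ℕ} {x : Fin m → A} {y : Fin n → A}
    (hr : ∀ j, x j ∈ (Ideal.span (Set.range y)).radical) : kgrSeq A M x ≤ kgrSeq A M y := by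
  refine (le_kgrSeq_iff y _).2 fun i hi => ?_
  refine KoszulExactAt.of_mem_radical (x := x) (fun j => ⟨1, one_mem _, by simpa using hr j⟩) ?_
  exact fun j hj => (le_kgrSeq_iff x _).1 le_rfl j (lt_of_le_of_lt (by exact_mod_cast hj) hi)

theorem kgrSeq_le_append_left {m n : ℕ} (x : Fin m → A) (y : Fin n → A) :
    kgrSeq A M x ≤ kgrSeq A M (Fin.append x y) :=
  kgrSeq_le_of_mem_radical fun j => Ideal.le_radical <| Ideal.subset_span
    ⟨Fin.castAdd n j, Fin.append_left x y j⟩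

theorem kgrSeq_le_append_right {m n : ℕ} (x : Fin m → A) (y : Fin n → A) :
    kgrSeq A M y ≤ kgrSeq A M (Fin.append x y) :=
  kgrSeq_le_of_mem_radical fun j => Ideal.le_radical <| Ideal.subset_span
    ⟨Fin.natAdd m j, Fin.append_right x y j⟩

/-- The Koszul complex on `d` elements of a proper prime is not exact in degree `d`. -/
theorem not_koszulExactAt_primeCompl {d : ℕ} (p : Ideal A) [p.IsPrime] {y : Fin d → A}
    (hy : ∀ j, y j ∈ p) : ¬ KoszulExactAt A p.primeCompl y Finset.univ d := by
  intro H
  obtain ⟨s, hs, h, hh⟩ := H 1 fun t _ ht => by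
    have := t.card_le_univ
    simp at this
    omega
  have := hh Finset.univ subset_rfl (by simp)
  rw [Pi.one_apply, smul_eq_mul, mul_one] at this
  refine hs (this ▸ sum_mem fun j _ => ?_)
  exact p.mul_mem_right _ (p.mul_mem_left _ (hy j))

theorem exists_mul_mem_radical_of_forall_prime {J p : Ideal A} [p.IsPrime] {a : A}
    (h : ∀ q : Ideal A, q.IsPrime → J ≤ q → q ≤ p → a ∈ q) : ∃ s ∉ p, s * a ∈ J.radical := by
  by_contra! H
  obtain ⟨q, hq, hJq, hd⟩ := Ideal.exists_le_prime_disjoint (I := J)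
    (p.primeCompl ⊔ Submonoid.powers a) (by
      rw [Set.disjoint_left]
      rintro z hz hz'
      obtain ⟨s, hs, _, ⟨n, rfl⟩, rfl⟩ := Submonoid.mem_sup.1 hz'
      refine H s hs ⟨n + 1, ?_⟩
      convert J.mul_mem_left (s ^ n * a) hz using 1
      ring)
  rw [Set.disjoint_left] at hd
  refine hd (h q hq hJq fun z hz => ?_) (Submonoid.mem_sup_right (Submonoid.mem_powers a))
  by_contra hzp
  exact hd hz (Submonoid.mem_sup_left hzp)

/-- **Local Kronecker theorem.** If chains of primes between `J` and `p` have length at most `d`,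
then, locally at `p`, adding multiples of `a ∈ p` to `d` given elements yields a sequence whose
radical modulo `J` contains `a`. -/
theorem exists_mul_mem_radical_sup_span (p : Ideal A) [hp : p.IsPrime] {a : A} (hap : a ∈ p)
    (d : ℕ) : ∀ (J : Ideal A), (∀ l : LTSeries (PrimeSpectrum A), J ≤ l.head.asIdeal →
      l.last.asIdeal ≤ p → l.length ≤ d) → ∀ b : Fin d → A, ∃ c : Fin d → A, ∃ s ∉ p,
        s * a ∈ (J ⊔ Ideal.span (Set.range fun i => b i + a * c i)).radical := by
  induction d with
  | zero =>
    intro J hJ b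
    obtain ⟨s, hs, hsa⟩ := exists_mul_mem_radical_of_forall_prime (J := J) (p := p) (a := a) (by
      intro q hq hJq hqp
      by_contra haq
      have hlt : (⟨q, hq⟩ : PrimeSpectrum A) < ⟨p, hp⟩ :=
        lt_of_le_of_ne hqp fun h => haq (by rw [PrimeSpectrum.mk.inj h]; exact hap)
      obtain ⟨l, hl, hl'⟩ : ∃ l : LTSeries (PrimeSpectrum A),
          l.head = ⟨p, hp⟩ ∧ l.last = ⟨p, hp⟩ := ⟨RelSeries.singleton _ _, rfl, rfl⟩
      rw [← hl] at hlt
      simpa using hJ (l.cons ⟨q, hq⟩ hlt) (by simpa using hJq) (by simp [hl']))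
    exact ⟨0, s, hs, Ideal.radical_mono le_sup_left hsa⟩
  | succ d ih =>
    intro J hJ b
    set e := b (Fin.last d) with he
    obtain ⟨c, s, hs, n, hn⟩ := ih (J ⊔ Ideal.span {e} ⊔ J.radical.colon {e}) (by
        intro l hl hlp
        obtain ⟨q, hq, hql⟩ := Ideal.exists_minimalPrimes_le
          (le_sup_left.trans (le_sup_left.trans hl))
        have hb : e ∈ l.head.asIdeal :=
          hl (Ideal.mem_sup_left (Ideal.mem_sup_right (Ideal.mem_span_singleton_self _)))
        have hlt : (⟨q, hq.1.1⟩ : PrimeSpectrum A) < l.head := by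
          refine lt_of_le_of_ne hql fun h => ?_
          obtain ⟨y, hy, hyb⟩ := exists_mul_mem_radical_of_forall_prime (J := J)
            (p := l.head.asIdeal) (a := e) (by
              intro q' hq' hJq' hle
              rw [← h] at hle hb
              exact hq.2 ⟨hq', hJq'⟩ hle hb)
          exact hy (hl (Ideal.mem_sup_right (Submodule.mem_colon_singleton.2 hyb)))
        have := hJ (l.cons ⟨q, hq.1.1⟩ hlt) (by simpa using hq.1.2) (by simpa using hlp)
        simpa using this)
      (fun i => b i.castSucc)
    obtain ⟨w, hw, k, hk, hn⟩ := Submodule.mem_sup.1 hn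
    obtain ⟨v, hv, z, hz, rfl⟩ := Submodule.mem_sup.1 hw
    obtain ⟨u, hu, r, hr, rfl⟩ := Submodule.mem_sup.1 hv
    obtain ⟨r, rfl⟩ := Ideal.mem_span_singleton'.1 hr
    refine ⟨Fin.snoc c z, s, hs, ?_⟩
    set K := J ⊔ Ideal.span (Set.range fun i => b i + a * (Fin.snoc c z : Fin (d + 1) → A) i)
    have hJK : J.radical ≤ K.radical := Ideal.radical_mono le_sup_left
    have hgen (i) : b i + a * (Fin.snoc c z : Fin (d + 1) → A) i ∈ K.radical :=
      Ideal.le_radical (Ideal.mem_sup_right (Ideal.subset_span ⟨i, rfl⟩))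
    have hez : z * e ∈ K.radical := hJK (Submodule.mem_colon_singleton.1 hz)
    have hlast : e + a * z ∈ K.radical := by simpa using hgen (Fin.last d)
    have heK : e ∈ K.radical := by
      rw [← Ideal.radical_idem]
      refine ⟨2, ?_⟩
      convert sub_mem (K.radical.mul_mem_left e hlast) (K.radical.mul_mem_left a hez) using 1
      ring
    have hazK : a * z ∈ K.radical := by simpa using sub_mem hlast heK
    have hkK : k ∈ K.radical := by
      refine (Ideal.span_le.2 ?_ : Ideal.span _ ≤ K.radical) hk
      rintro _ ⟨i, rfl⟩
      simpa using hgen i.castSucc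
    rw [← Ideal.radical_idem]
    refine ⟨n + 1, ?_⟩
    rw [pow_succ, ← hn]
    have := add_mem (add_mem (add_mem (K.radical.mul_mem_left (s * a) (hJK (Ideal.le_radical hu)))
      (K.radical.mul_mem_left (s * a * r) heK)) (K.radical.mul_mem_left s hazK))
      (K.radical.mul_mem_left (s * a) hkK)
    convert this using 1
    ring

/-- Locally at a prime `p` of height at most `d`, finitely many elements of `p` lie in the radical
of an ideal generated by `d` elements of `p`. -/
theorem exists_forall_mul_mem_radical_span (p : PrimeSpectrum A) {d : ℕ}
    (hd : Order.height p ≤ d) {n : ℕ} (x : Fin n → A) (hx : ∀ j, x j ∈ p.asIdeal) :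
    ∃ y : Fin d → A, (∀ i, y i ∈ p.asIdeal) ∧
      ∀ j, ∃ s ∉ p.asIdeal, s * x j ∈ (Ideal.span (Set.range y)).radical := by
  induction n with
  | zero => exact ⟨0, by simp, fun j => j.elim0⟩
  | succ n ih =>
    obtain ⟨b, hb, hbx⟩ := ih (fun j => x j.castSucc) fun j => hx _
    obtain ⟨c, s, hs, hsa⟩ := exists_mul_mem_radical_sup_span p.asIdeal (hx (Fin.last n)) d ⊥
      (fun l _ hl => by exact_mod_cast (Order.length_le_height (x := p) hl).trans hd) b
    rw [bot_sup_eq] at hsa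
    refine ⟨_, fun i => add_mem (hb i) (p.asIdeal.mul_mem_right (c i) (hx (Fin.last n))),
      Fin.lastCases ⟨s, hs, hsa⟩ fun j => ?_⟩
    set K := Ideal.span (Set.range fun i => b i + x (Fin.last n) * c i)
    have hbK : ∀ w ∈ Ideal.span (Set.range b), s * w ∈ K.radical := by
      have : Ideal.span (Set.range b) ≤ K.radical.colon {s} := by
        refine Ideal.span_le.2 ?_
        rintro _ ⟨i, rfl⟩
        refine Submodule.mem_colon_singleton.2 ?_
        have hi : b i + x (Fin.last n) * c i ∈ K.radical :=
          Ideal.le_radical (Ideal.subset_span ⟨i, rfl⟩)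
        convert sub_mem (K.radical.mul_mem_left s hi) (K.radical.mul_mem_left (c i) hsa) using 1
        simp only [smul_eq_mul]
        ring
      intro w hw
      rw [mul_comm]
      exact Submodule.mem_colon_singleton.1 (this hw)
    obtain ⟨s', hs', m, hm⟩ := hbx j
    refine ⟨s * s', p.asIdeal.primeCompl.mul_mem hs hs', ?_⟩
    rw [← Ideal.radical_idem]
    refine ⟨m + 1, ?_⟩
    convert K.radical.mul_mem_left (s ^ m * s' * x j.castSucc) (hbK _ hm) using 1
    ring

theorem kgr_le_idealHeight (𝔞 : Ideal A) : kgr A 𝔞 A ≤ idealHeight A 𝔞 := by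
  refine le_iInf₂ fun p hp => iSup_le fun n => iSup₂_le fun x hx => ?_
  by_contra! hlt
  obtain ⟨d, hd⟩ := ENat.ne_top_iff_exists.1 (ne_top_of_lt hlt)
  obtain ⟨y, hy, hxy⟩ := exists_forall_mul_mem_radical_span p hd.ge x fun j => hp (hx j)
  refine not_koszulExactAt_primeCompl p.asIdeal hy (KoszulExactAt.of_mem_radical hxy ?_)
  intro j hj
  refine KoszulExactAt.mono bot_le ((le_kgrSeq_iff x _).1 le_rfl j (lt_of_le_of_lt ?_ hlt))
  rw [← hd]
  exact_mod_cast hj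

end KoszulGrade

section TrivSqZeroExt

variable {A M : Type*} [CommRing A] [AddCommGroup M] [Module A M] [Module Aᵐᵒᵖ M]
  [IsCentralScalar A M]

open TrivSqZeroExt

theorem koszulDiff_inl {n : ℕ} (x : Fin n → A) (g : Finset (Fin n) → TrivSqZeroExt A M)
    (t : Finset (Fin n)) :
    koszulDiff (fun j => (inl (x j) : TrivSqZeroExt A M)) g t = koszulDiff x g t := by
  refine Finset.sum_congr rfl fun j _ => ?_
  rw [← algebraMap_smul (TrivSqZeroExt A M) (_ * x j), map_mul, map_pow, map_neg, map_one]
  rfl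

theorem koszulExactAt_inl_iff {n : ℕ} (x : Fin n → A) (i : ℕ) :
    KoszulExactAt (TrivSqZeroExt A M) ⊥ (fun j => (inl (x j) : TrivSqZeroExt A M)) Finset.univ i ↔
      KoszulExactAt A ⊥ x Finset.univ i ∧ KoszulExactAt M ⊥ x Finset.univ i := by
  simp only [KoszulExactAt, Submonoid.mem_bot, exists_eq_left, one_smul, Finset.subset_univ,
    true_imp_iff, koszulDiff_inl]
  have hfst (g : Finset (Fin n) → TrivSqZeroExt A M) (t) :
      (koszulDiff x g t).fst = koszulDiff x (fun u => (g u).fst) t :=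
    (koszulDiff_comp_linearMap x (fstHom A A M).toLinearMap g t).symm
  have hsnd (g : Finset (Fin n) → TrivSqZeroExt A M) (t) :
      (koszulDiff x g t).snd = koszulDiff x (fun u => (g u).snd) t :=
    (koszulDiff_comp_linearMap x (sndHom A M) g t).symm
  have hinl (g : Finset (Fin n) → A) (t) :
      koszulDiff x (fun u => (inl (g u) : TrivSqZeroExt A M)) t = inl (koszulDiff x g t) :=
    koszulDiff_comp_linearMap x (Algebra.linearMap A (TrivSqZeroExt A M)) g t
  have hinr (g : Finset (Fin n) → M) (t) :
      koszulDiff x (fun u => (inr (g u) : TrivSqZeroExt A M)) t = inr (koszulDiff x g t) :=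
    koszulDiff_comp_linearMap x (inrHom A M) g t
  constructor
  · intro H
    constructor
    · intro g hg
      obtain ⟨h, hh⟩ := H (fun u => inl (g u)) fun t ht => by rw [hinl, hg t ht, inl_zero]
      exact ⟨fun u => (h u).fst, fun t ht => by rw [← hfst, hh t ht, fst_inl]⟩
    · intro g hg
      obtain ⟨h, hh⟩ := H (fun u => inr (g u)) fun t ht => by rw [hinr, hg t ht, inr_zero]
      exact ⟨fun u => (h u).snd, fun t ht => by rw [← hsnd, hh t ht, snd_inr]⟩
  · rintro ⟨HA, HM⟩ g hg
    obtain ⟨h, hh⟩ := HA (fun u => (g u).fst) fun t ht => by rw [← hfst, hg t ht, fst_zero]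
    obtain ⟨k, hk⟩ := HM (fun u => (g u).snd) fun t ht => by rw [← hsnd, hg t ht, snd_zero]
    refine ⟨fun u => inl (h u) + inr (k u), fun t ht => TrivSqZeroExt.ext ?_ ?_⟩
    · rw [hfst, ← hh t ht]; simp
    · rw [hsnd, ← hk t ht]; simp

theorem kgrSeq_inl {n : ℕ} (x : Fin n → A) :
    kgrSeq (TrivSqZeroExt A M) (TrivSqZeroExt A M) (fun j => (inl (x j) : TrivSqZeroExt A M)) =
      kgrSeq A A x ⊓ kgrSeq A M x := by
  refine eq_of_forall_le_iff fun c => ?_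
  simp only [le_inf_iff, le_kgrSeq_iff, koszulExactAt_inl_iff, imp_and, forall_and]

theorem inl_fst_mem_iff {J : Ideal (TrivSqZeroExt A M)} (hJ : J.IsRadical)
    (r : TrivSqZeroExt A M) : (inl r.fst : TrivSqZeroExt A M) ∈ J ↔ r ∈ J := by
  have hr : inr r.snd ∈ J := hJ ⟨2, by rw [pow_two, inr_mul_inr]; exact zero_mem J⟩
  conv_rhs => rw [← inl_fst_add_inr_snd_eq r]
  exact (J.add_mem_iff_left hr).symm

theorem kgrSeq_trivSqZeroExt {n : ℕ} (x : Fin n → TrivSqZeroExt A M) :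
    kgrSeq (TrivSqZeroExt A M) (TrivSqZeroExt A M) x =
      kgrSeq A A (fun j => (x j).fst) ⊓ kgrSeq A M (fun j => (x j).fst) := by
  rw [← kgrSeq_inl]
  apply le_antisymm <;> refine kgrSeq_le_of_mem_radical fun j => ?_
  · rw [← inl_fst_mem_iff (Ideal.radical_isRadical _)]
    exact Ideal.le_radical (Ideal.subset_span ⟨j, rfl⟩)
  · rw [inl_fst_mem_iff (Ideal.radical_isRadical _)]
    exact Ideal.le_radical (Ideal.subset_span ⟨j, rfl⟩)

theorem fstHom_surjective : Function.Surjective (fstHom A A M) := fun a => ⟨inl a, rfl⟩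

theorem kgr_trivSqZeroExt (𝔟 : Ideal (TrivSqZeroExt A M)) :
    kgr (TrivSqZeroExt A M) 𝔟 (TrivSqZeroExt A M) =
      kgr A (𝔟.map (fstHom A A M)) A ⊓ kgr A (𝔟.map (fstHom A A M)) M := by
  apply le_antisymm
  · refine iSup_le fun n => iSup₂_le fun x hx => ?_
    have hx' (j) : (x j).fst ∈ 𝔟.map (fstHom A A M) :=
      Ideal.mem_map_of_mem (fstHom A A M) (hx j)
    rw [kgrSeq_trivSqZeroExt]
    exact inf_le_inf (le_iSup_of_le n (le_iSup₂_of_le (fun j => (x j).fst) hx' le_rfl))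
      (le_iSup_of_le n (le_iSup₂_of_le (fun j => (x j).fst) hx' le_rfl))
  · simp only [kgr, iSup_inf_eq, inf_iSup_eq]
    refine iSup_le fun n => iSup₂_le fun y hy => iSup_le fun m => iSup₂_le fun x hx => ?_
    have hxy (j) : Fin.append x y j ∈ 𝔟.map (fstHom A A M) :=
      Fin.addCases (fun j => by simpa using hx j) (fun j => by simpa using hy j) j
    choose z hz hzf using fun j =>
      (Ideal.mem_map_iff_of_surjective (fstHom A A M) fstHom_surjective).1 (hxy j)
    have hzf' : (fun j => (z j).fst) = Fin.append x y := funext hzf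
    refine le_trans ?_ (le_iSup_of_le _ (le_iSup₂_of_le z hz le_rfl))
    rw [kgrSeq_trivSqZeroExt, hzf']
    exact inf_le_inf (kgrSeq_le_append_left x y) (kgrSeq_le_append_right x y)

/-- The prime spectra of `A` and of its trivial extension by `M` are isomorphic. -/
def primeSpectrumTrivSqZeroExt (A M : Type*) [CommRing A] [AddCommGroup M] [Module A M]
    [Module Aᵐᵒᵖ M] [IsCentralScalar A M] :
    PrimeSpectrum A ≃o PrimeSpectrum (TrivSqZeroExt A M) where
  toFun := PrimeSpectrum.comap (fstHom A A M).toRingHom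
  invFun := PrimeSpectrum.comap (inlHom A M)
  left_inv _ := PrimeSpectrum.ext (Ideal.ext fun _ => Iff.rfl)
  right_inv q := PrimeSpectrum.ext (Ideal.ext fun r => inl_fst_mem_iff q.2.isRadical r)
  map_rel_iff' := ⟨fun h a ha => h (show (inl a : TrivSqZeroExt A M) ∈ _ from ha),
    fun h _ hr => h hr⟩

theorem idealHeight_trivSqZeroExt (𝔟 : Ideal (TrivSqZeroExt A M)) :
    idealHeight (TrivSqZeroExt A M) 𝔟 = idealHeight A (𝔟.map (fstHom A A M)) := by
  have hle (p : PrimeSpectrum A) : 𝔟 ≤ (primeSpectrumTrivSqZeroExt A M p).asIdeal ↔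
      𝔟.map (fstHom A A M) ≤ p.asIdeal := Ideal.map_le_iff_le_comap.symm
  simp only [idealHeight]
  rw [← (primeSpectrumTrivSqZeroExt A M).surjective.iInf_comp]
  simp only [hle, Order.height_orderIso]

theorem isCMIdeals_trivSqZeroExt_iff_forall :
    IsCMIdeals (TrivSqZeroExt A M) ↔
      ∀ 𝔞 : Ideal A, idealHeight A 𝔞 = kgr A 𝔞 A ⊓ kgr A 𝔞 M := by
  simp only [IsCMIdeals, kgr_trivSqZeroExt, idealHeight_trivSqZeroExt]
  refine ⟨fun h 𝔞 => ?_, fun h 𝔟 => h _⟩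
  simpa only [Ideal.map_comap_of_surjective _ fstHom_surjective] using
    h (𝔞.comap (fstHom A A M))

end TrivSqZeroExt

/-- The trivial extension (Nagata idealization) `A⋉M` is Cohen-Macaulay
in the sense of ideals iff `A` is Cohen-Macaulay in the sense of ideals and
`kgr_A(𝔞, M) ≥ height 𝔞` for every ideal `𝔞` of `A`. -/
theorem isCMIdeals_trivSqZeroExt_iff {A : Type*} [CommRing A] (M : Type*)
    [AddCommGroup M] [Module A M] :
    letI : Module Aᵐᵒᵖ M := Module.compHom M ((RingHom.id A).fromOpposite Commute.all)
    letI : IsCentralScalar A M := ⟨fun _ _ => rfl⟩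
    (IsCMIdeals (TrivSqZeroExt A M) ↔
      IsCMIdeals A ∧ ∀ 𝔞 : Ideal A, idealHeight A 𝔞 ≤ kgr A 𝔞 M) := by
  let : Module Aᵐᵒᵖ M := Module.compHom M ((RingHom.id A).fromOpposite Commute.all)
  let : IsCentralScalar A M := ⟨fun _ _ => rfl⟩
  refine isCMIdeals_trivSqZeroExt_iff_forall.trans ⟨fun h => ⟨fun 𝔞 => ?_, fun 𝔞 => ?_⟩, ?_⟩
  · exact le_antisymm ((h 𝔞).trans_le inf_le_left) (kgr_le_idealHeight 𝔞)
  · exact (h 𝔞).trans_le inf_le_right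
  · rintro ⟨hA, hM⟩ 𝔞
    rw [← hA 𝔞, inf_eq_left.2 (hM 𝔞)]
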